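/- Assume the Lr (a,τ) interval exchange transformation T is irreducible and satisfies the Keane Condition. If α ≠ β are points of X, then the pair {α, β} is positively asymptotic if and only if there exist i ∈ {1,…,n−1} and k ∈ ℤ such that, with x = b^τ_i ∈ D^τ, {α, β} = {S^k 𝓘(x), S^k 𝓘̃(x)}. -/

import Mathlib

open Set

noncomputable section

/-- `bpt a k = a_1 + ⋯ + a_k` (0-indexed: the sum of the first `k` entries of `a`);
these are the division points `b_k` of the interval exchange. -/
def bpt {n : ℕ} (a : Fin n → ℝ) (k : ℕ) : ℝ :=
  ∑ j ∈ Finset.univ.filter (fun j : Fin n => (j : ℕ) < k), a j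

/-- The left-closed right-open interval `J_i = [b_{i-1}, b_i)` (0-indexed). -/
def Jint {n : ℕ} (a : Fin n → ℝ) (i : Fin n) : Set ℝ :=
  Set.Ico (bpt a (i : ℕ)) (bpt a ((i : ℕ) + 1))

/-- The left-open right-closed interval `J̃_i = (b_{i-1}, b_i]` (0-indexed). -/
def Jtil {n : ℕ} (a : Fin n → ℝ) (i : Fin n) : Set ℝ :=
  Set.Ioc (bpt a (i : ℕ)) (bpt a ((i : ℕ) + 1))

/-- The permuted probability vector `a^τ`, with `a^τ_{τ(i)} = a_i`. -/
def aperm {n : ℕ} (a : Fin n → ℝ) (τ : Equiv.Perm (Fin n)) : Fin n → ℝ :=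
  fun j => a (τ.symm j)

/-- The set `D = {b_1, …, b_{n-1}}` of interior division points. -/
def Dset {n : ℕ} (a : Fin n → ℝ) : Set ℝ :=
  {x | ∃ k : ℕ, 0 < k ∧ k < n ∧ x = bpt a k}

/-- `a` is a positive probability vector. -/
def IsProbVec {n : ℕ} (a : Fin n → ℝ) : Prop :=
  (∀ i, 0 < a i) ∧ ∑ i, a i = 1

/-- `T` is the Lr `(a,τ)` interval exchange transformation: on each
`J_i = [b_{i-1}, b_i)` it is the translation `x ↦ x - b_{i-1} + b^τ_{τ(i)-1}`. -/
def IsLrIET {n : ℕ} (a : Fin n → ℝ) (τ : Equiv.Perm (Fin n)) (T : ℝ → ℝ) : Prop :=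
  ∀ i : Fin n, ∀ x ∈ Jint a i, T x = x - bpt a (i : ℕ) + bpt (aperm a τ) ((τ i : ℕ))

/-- `Tt` is the dual lR `(a,τ)` interval exchange transformation: on each
`J̃_i = (b_{i-1}, b_i]` it is the translation `x ↦ x - b_{i-1} + b^τ_{τ(i)-1}`. -/
def IslRIET {n : ℕ} (a : Fin n → ℝ) (τ : Equiv.Perm (Fin n)) (Tt : ℝ → ℝ) : Prop :=
  ∀ i : Fin n, ∀ x ∈ Jtil a i, Tt x = x - bpt a (i : ℕ) + bpt (aperm a τ) ((τ i : ℕ))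

/-- The Keane Condition: `D ∩ T^k(D) = ∅` for every positive integer `k`. -/
def KeaneCond {n : ℕ} (a : Fin n → ℝ) (T : ℝ → ℝ) : Prop :=
  ∀ k : ℕ, 0 < k → Dset a ∩ (T^[k] '' Dset a) = ∅

/-- `τ` is irreducible: `τ({1,…,j}) ≠ {1,…,j}` for `j = 1, …, n-1` (0-indexed:
no proper initial segment is invariant). -/
def IrreduciblePerm {n : ℕ} (τ : Equiv.Perm (Fin n)) : Prop :=
  ∀ j : ℕ, 0 < j → j < n →
    (fun i => τ i) '' {i : Fin n | (i : ℕ) < j} ≠ {i : Fin n | (i : ℕ) < j}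

/-- `P` is the family of ℤ-iterates of `T` on `[0,1)`: `P 0 = id`,
`P (k+1) = T ∘ P k`, and each `P k` maps `[0,1)` into itself. -/
def IsZIterLr (T : ℝ → ℝ) (P : ℤ → ℝ → ℝ) : Prop :=
  (∀ x ∈ Set.Ico (0 : ℝ) 1, P 0 x = x) ∧
  ∀ k : ℤ, ∀ x ∈ Set.Ico (0 : ℝ) 1, P k x ∈ Set.Ico (0 : ℝ) 1 ∧ P (k + 1) x = T (P k x)

/-- `Pt` is the family of ℤ-iterates of `Tt` on `(0,1]`. -/
def IsZIterlR (Tt : ℝ → ℝ) (Pt : ℤ → ℝ → ℝ) : Prop :=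
  (∀ x ∈ Set.Ioc (0 : ℝ) 1, Pt 0 x = x) ∧
  ∀ k : ℤ, ∀ x ∈ Set.Ioc (0 : ℝ) 1, Pt k x ∈ Set.Ioc (0 : ℝ) 1 ∧ Pt (k + 1) x = Tt (Pt k x)

/-- `I` is the itinerary map of `T` (with ℤ-iterates `P`):
`𝓘(x)_k = i ↔ T^k x ∈ J_i` for `x ∈ [0,1)`. -/
def IsItin {n : ℕ} (a : Fin n → ℝ) (P : ℤ → ℝ → ℝ) (I : ℝ → ℤ → Fin n) : Prop :=
  ∀ x ∈ Set.Ico (0 : ℝ) 1, ∀ k : ℤ, ∀ i : Fin n, (I x k = i ↔ P k x ∈ Jint a i)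

/-- `It` is the itinerary map of `Tt` (with ℤ-iterates `Pt`):
`𝓘̃(x)_k = i ↔ T̃^k x ∈ J̃_i` for `x ∈ (0,1]`. -/
def IsItinDual {n : ℕ} (a : Fin n → ℝ) (Pt : ℤ → ℝ → ℝ) (It : ℝ → ℤ → Fin n) : Prop :=
  ∀ x ∈ Set.Ioc (0 : ℝ) 1, ∀ k : ℤ, ∀ i : Fin n, (It x k = i ↔ Pt k x ∈ Jtil a i)

/-- `D_∞ = {0,1} ∪ ⋃_{k ∈ ℤ} T^k(D)`. -/
def Dinf {n : ℕ} (a : Fin n → ℝ) (P : ℤ → ℝ → ℝ) : Set ℝ :=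
  {0, 1} ∪ ⋃ k : ℤ, P k '' Dset a

/-- The set `R = [0,1] ∖ D_∞` of regular points. -/
def Rset {n : ℕ} (a : Fin n → ℝ) (P : ℤ → ℝ → ℝ) : Set ℝ :=
  Set.Icc 0 1 \ Dinf a P

/-- The shift `S` on `Ω = {1,…,n}^ℤ`: `S(α)_i = α_{i+1}`. -/
def shiftS {n : ℕ} (α : ℤ → Fin n) : ℤ → Fin n := fun i => α (i + 1)

/-- The `k`-th power of the shift: `(S^k α)_i = α_{i+k}`. -/
def shiftZ {n : ℕ} (k : ℤ) (α : ℤ → Fin n) : ℤ → Fin n := fun i => α (i + k)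

/-- `α, β` are positively asymptotic: `α_i = β_i` for all `i ≥ N`, some `N`. -/
def PosAsymp {n : ℕ} (α β : ℤ → Fin n) : Prop :=
  ∃ N : ℕ, ∀ i : ℤ, (N : ℤ) ≤ i → α i = β i

/-- `α, β` are negatively asymptotic: `α_i = β_i` for all `i ≤ -N`, some `N`. -/
def NegAsymp {n : ℕ} (α β : ℤ → Fin n) : Prop :=
  ∃ N : ℕ, ∀ i : ℤ, i ≤ -(N : ℤ) → α i = β i

section DivisionPoints

variable {n : ℕ} {a : Fin n → ℝ}

theorem bpt_zero (a : Fin n → ℝ) : bpt a 0 = 0 := by simp [bpt]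

theorem bpt_succ (a : Fin n → ℝ) (i : Fin n) : bpt a ((i : ℕ) + 1) = bpt a i + a i := by
  have h : Finset.univ.filter (fun j : Fin n => (j : ℕ) < (i : ℕ) + 1)
      = insert i (Finset.univ.filter (fun j : Fin n => (j : ℕ) < (i : ℕ))) := by
    ext j
    simp only [Finset.mem_filter, Finset.mem_univ, true_and, Finset.mem_insert, Fin.ext_iff]
    omega
  rw [bpt, h, Finset.sum_insert (by simp), bpt, add_comm]

theorem bpt_self (ha : IsProbVec a) : bpt a n = 1 := by
  rw [← ha.2, bpt]
  congr 1
  ext j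
  simp

theorem bpt_mono (ha : IsProbVec a) {k l : ℕ} (h : k ≤ l) : bpt a k ≤ bpt a l := by
  refine Finset.sum_le_sum_of_subset_of_nonneg ?_ (fun i _ _ => (ha.1 i).le)
  intro j
  simp only [Finset.mem_filter, Finset.mem_univ, true_and]
  omega

theorem bpt_lt_succ (ha : IsProbVec a) (i : Fin n) : bpt a i < bpt a ((i : ℕ) + 1) := by
  rw [bpt_succ]
  linarith [ha.1 i]

theorem bpt_nonneg (ha : IsProbVec a) (k : ℕ) : 0 ≤ bpt a k := by
  simpa [bpt_zero] using bpt_mono ha (Nat.zero_le k)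

theorem bpt_pos (ha : IsProbVec a) {k : ℕ} (hk : 0 < k) (hkn : k ≤ n) : 0 < bpt a k := by
  have h := bpt_lt_succ ha ⟨0, by omega⟩
  simp only [bpt_zero] at h
  exact h.trans_le (bpt_mono ha hk)

theorem bpt_le_one (ha : IsProbVec a) {k : ℕ} (hk : k ≤ n) : bpt a k ≤ 1 := by
  simpa [bpt_self ha] using bpt_mono ha hk

theorem bpt_lt_one (ha : IsProbVec a) {k : ℕ} (hk : k < n) : bpt a k < 1 :=
  (bpt_lt_succ ha ⟨k, hk⟩).trans_le (bpt_le_one ha hk)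

theorem exists_mem_Jint (ha : IsProbVec a) {x : ℝ} (hx : x ∈ Ico (0 : ℝ) 1) :
    ∃ i, x ∈ Jint a i := by
  classical
  have hex : ∃ k, x < bpt a k := ⟨n, by rw [bpt_self ha]; exact hx.2⟩
  have hle : Nat.find hex ≤ n := Nat.find_min' hex (by rw [bpt_self ha]; exact hx.2)
  have hlt := Nat.find_spec hex
  obtain h0 | ⟨k, hk⟩ : Nat.find hex = 0 ∨ ∃ k, Nat.find hex = k + 1 := by
    cases Nat.find hex <;> simp
  · rw [h0, bpt_zero] at hlt
    exact absurd hx.1 hlt.not_ge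
  · rw [hk] at hlt
    exact ⟨⟨k, by omega⟩, not_lt.1 (Nat.find_min hex (by simp only; omega)), hlt⟩

theorem Jint_subset (ha : IsProbVec a) (i : Fin n) : Jint a i ⊆ Ico 0 1 := fun _ hx =>
  ⟨(bpt_nonneg ha _).trans hx.1, hx.2.trans_le (bpt_le_one ha i.2)⟩

theorem Jint_unique (ha : IsProbVec a) {x : ℝ} {i j : Fin n} (hi : x ∈ Jint a i)
    (hj : x ∈ Jint a j) : i = j := by
  rcases lt_trichotomy i j with h | h | h
  · exact absurd (hi.2.trans_le ((bpt_mono ha (Fin.lt_def.1 h)).trans hj.1)) (lt_irrefl _)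
  · exact h
  · exact absurd (hj.2.trans_le ((bpt_mono ha (Fin.lt_def.1 h)).trans hi.1)) (lt_irrefl _)

theorem Jtil_unique (ha : IsProbVec a) {x : ℝ} {i j : Fin n} (hi : x ∈ Jtil a i)
    (hj : x ∈ Jtil a j) : i = j := by
  rcases lt_trichotomy i j with h | h | h
  · exact absurd (hi.2.trans_lt ((bpt_mono ha (Fin.lt_def.1 h)).trans_lt hj.1)) (lt_irrefl _)
  · exact h
  · exact absurd (hj.2.trans_lt ((bpt_mono ha (Fin.lt_def.1 h)).trans_lt hi.1)) (lt_irrefl _)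

theorem exists_mem_Jtil (ha : IsProbVec a) {x : ℝ} (hx : x ∈ Ioc (0 : ℝ) 1) :
    ∃ i, x ∈ Jtil a i := by
  classical
  have hex : ∃ k, x ≤ bpt a k := ⟨n, by rw [bpt_self ha]; exact hx.2⟩
  have hle : Nat.find hex ≤ n := Nat.find_min' hex (by rw [bpt_self ha]; exact hx.2)
  have hlt := Nat.find_spec hex
  obtain h0 | ⟨k, hk⟩ : Nat.find hex = 0 ∨ ∃ k, Nat.find hex = k + 1 := by
    cases Nat.find hex <;> simp
  · rw [h0, bpt_zero] at hlt
    exact absurd hx.1 hlt.not_gt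
  · rw [hk] at hlt
    exact ⟨⟨k, by omega⟩, not_le.1 (Nat.find_min hex (by simp only; omega)), hlt⟩

theorem IsProbVec.aperm (ha : IsProbVec a) (τ : Equiv.Perm (Fin n)) :
    IsProbVec (aperm a τ) :=
  ⟨fun _ => ha.1 _, (Equiv.sum_comp τ.symm a).trans ha.2⟩

theorem bpt_aperm_succ (a : Fin n → ℝ) (τ : Equiv.Perm (Fin n)) (i : Fin n) :
    bpt (aperm a τ) ((τ i : ℕ) + 1) = bpt (aperm a τ) (τ i) + a i := by
  rw [bpt_succ]
  simp [aperm]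

end DivisionPoints

/-- The translation length of the interval exchange on its `i`-th interval. -/
def displacement {n : ℕ} (a : Fin n → ℝ) (τ : Equiv.Perm (Fin n)) (i : Fin n) : ℝ :=
  bpt (aperm a τ) (τ i) - bpt a i

section Exchange

variable {n : ℕ} {a : Fin n → ℝ} {τ : Equiv.Perm (Fin n)} {T Tt : ℝ → ℝ}

theorem IsLrIET.apply_eq (hT : IsLrIET a τ T) {i : Fin n} {x : ℝ} (hx : x ∈ Jint a i) :
    T x = x + displacement a τ i := by
  rw [hT i x hx, displacement]
  ring

theorem IslRIET.apply_eq (hTt : IslRIET a τ Tt) {i : Fin n} {x : ℝ} (hx : x ∈ Jtil a i) :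
    Tt x = x + displacement a τ i := by
  rw [hTt i x hx, displacement]
  ring

theorem add_displacement_mem_Jint {i : Fin n} {x : ℝ} :
    x + displacement a τ i ∈ Jint (aperm a τ) (τ i) ↔ x ∈ Jint a i := by
  simp only [Jint, mem_Ico, bpt_aperm_succ, bpt_succ a i, displacement]
  constructor <;> rintro ⟨h1, h2⟩ <;> constructor <;> linarith

theorem add_displacement_mem_Jtil {i : Fin n} {x : ℝ} :
    x + displacement a τ i ∈ Jtil (aperm a τ) (τ i) ↔ x ∈ Jtil a i := by
  simp only [Jtil, mem_Ioc, bpt_aperm_succ, bpt_succ a i, displacement]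
  constructor <;> rintro ⟨h1, h2⟩ <;> constructor <;> linarith

theorem IsLrIET.mapsTo (ha : IsProbVec a) (hT : IsLrIET a τ T) :
    MapsTo T (Ico 0 1) (Ico 0 1) := by
  intro x hx
  obtain ⟨i, hi⟩ := exists_mem_Jint ha hx
  rw [hT.apply_eq hi]
  exact Jint_subset (ha.aperm τ) _ (add_displacement_mem_Jint.2 hi)

theorem IsLrIET.injOn (ha : IsProbVec a) (hT : IsLrIET a τ T) : InjOn T (Ico 0 1) := by
  intro x hx y hy hxy
  obtain ⟨i, hi⟩ := exists_mem_Jint ha hx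
  obtain ⟨j, hj⟩ := exists_mem_Jint ha hy
  rw [hT.apply_eq hi, hT.apply_eq hj] at hxy
  have hi' := add_displacement_mem_Jint (τ := τ).2 hi
  have hj' := add_displacement_mem_Jint (τ := τ).2 hj
  rw [hxy] at hi'
  obtain rfl := τ.injective (Jint_unique (ha.aperm τ) hi' hj')
  exact add_right_cancel hxy

theorem IslRIET.injOn (ha : IsProbVec a) (hTt : IslRIET a τ Tt) : InjOn Tt (Ioc 0 1) := by
  intro x hx y hy hxy
  obtain ⟨i, hi⟩ := exists_mem_Jtil ha hx
  obtain ⟨j, hj⟩ := exists_mem_Jtil ha hy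
  rw [hTt.apply_eq hi, hTt.apply_eq hj] at hxy
  have hi' := add_displacement_mem_Jtil (τ := τ).2 hi
  have hj' := add_displacement_mem_Jtil (τ := τ).2 hj
  rw [hxy] at hi'
  obtain rfl := τ.injective (Jtil_unique (ha.aperm τ) hi' hj')
  exact add_right_cancel hxy

theorem IsLrIET.exists_bpt_eq_zero (hn : 2 ≤ n) (ha : IsProbVec a) (hT : IsLrIET a τ T)
    (hirr : IrreduciblePerm τ) : ∃ d ∈ Dset a, T d = 0 := by
  set z : Fin n := ⟨0, by omega⟩ with hz
  have hτ : τ z ≠ z := by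
    intro h
    refine hirr 1 one_pos (by omega) ?_
    have : {i : Fin n | (i : ℕ) < 1} = {z} := by
      ext i
      simp [hz, Fin.ext_iff]
    rw [this, image_singleton, h]
  have hi : τ.symm z ≠ z := fun h => hτ ((Equiv.symm_apply_eq τ).1 h).symm
  refine ⟨bpt a (τ.symm z), ⟨_, ?_, (τ.symm z).2, rfl⟩, ?_⟩
  · exact Nat.pos_of_ne_zero fun h => hi (Fin.ext h)
  · rw [hT.apply_eq ⟨le_rfl, bpt_lt_succ ha _⟩, displacement]
    simp [hz, bpt_zero]

theorem KeaneCond.iterate_notMem (hK : KeaneCond a T) {k : ℕ} (hk : 0 < k) {d : ℝ}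
    (hd : d ∈ Dset a) : T^[k] d ∉ Dset a := fun h =>
  (Set.eq_empty_iff_forall_notMem.1 (hK k hk)) _ ⟨h, d, hd, rfl⟩

theorem Dset_subset (ha : IsProbVec a) : Dset a ⊆ Ioo 0 1 := by
  rintro _ ⟨k, h0, hk, rfl⟩
  exact ⟨bpt_pos ha h0 hk.le, bpt_lt_one ha hk⟩

theorem bpt_eq_zero_or_mem_Dset (a : Fin n → ℝ) (i : Fin n) : bpt a i = 0 ∨ bpt a i ∈ Dset a := by
  rcases Nat.eq_zero_or_pos (i : ℕ) with h | h
  · left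
    rw [h, bpt_zero]
  · exact Or.inr ⟨i, h, i.2, rfl⟩

/-- The left endpoint of an exchanged interval is not periodic. -/
theorem KeaneCond.iterate_bpt_ne (hn : 2 ≤ n) (ha : IsProbVec a) (hT : IsLrIET a τ T)
    (hirr : IrreduciblePerm τ) (hK : KeaneCond a T) (i : Fin n) {m : ℕ} (hm : 0 < m) :
    T^[m] (bpt a i) ≠ bpt a i := by
  intro h
  rcases bpt_eq_zero_or_mem_Dset a i with h0 | hD
  · obtain ⟨d, hd, hTd⟩ := hT.exists_bpt_eq_zero hn ha hirr
    rw [h0, ← hTd, ← Function.iterate_succ_apply, Function.iterate_succ_apply'] at h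
    have hdI := Ioo_subset_Ico_self (Dset_subset ha hd)
    have := hT.injOn ha ((hT.mapsTo ha).iterate m hdI) hdI h
    exact hK.iterate_notMem hm hd (this.symm ▸ hd)
  · exact hK.iterate_notMem hm hD (h.symm ▸ hD)

theorem KeaneCond.aperiodic (hn : 2 ≤ n) (ha : IsProbVec a) (hT : IsLrIET a τ T)
    (hirr : IrreduciblePerm τ) (hK : KeaneCond a T) {x : ℝ} (hx : x ∈ Ico (0 : ℝ) 1) {m : ℕ}
    (hm : 0 < m) : T^[m] x ≠ x := by
  intro h
  have hmem : ∀ j, ∃ i, T^[j] x ∈ Jint a i := fun j =>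
    exists_mem_Jint ha ((hT.mapsTo ha).iterate j hx)
  choose i hi using hmem
  obtain ⟨j₀, hj₀, hmin⟩ := Finset.exists_min_image (Finset.range m)
    (fun j => T^[j] x - bpt a (i j)) ⟨0, Finset.mem_range.2 hm⟩
  set δ := T^[j₀] x - bpt a (i j₀) with hδ
  have hδ0 : 0 ≤ δ := sub_nonneg.2 (hi j₀).1
  have hshift : ∀ j ≤ m, T^[j] (x - δ) = T^[j] x - δ := by
    intro j
    induction j with
    | zero => simp
    | succ j ih =>
      intro hj
      have hmj := hmin j (Finset.mem_range.2 hj)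
      have hmem : T^[j] x - δ ∈ Jint a (i j) := ⟨by linarith, by linarith [(hi j).2]⟩
      rw [Function.iterate_succ_apply', Function.iterate_succ_apply', ih (by omega),
        hT.apply_eq hmem, hT.apply_eq (hi j)]
      ring
  have hper : T^[m] (x - δ) = x - δ := by rw [hshift m le_rfl, h]
  have hend : T^[j₀] (x - δ) = bpt a (i j₀) := by
    rw [hshift j₀ (Finset.mem_range.1 hj₀).le, hδ]
    ring
  refine hK.iterate_bpt_ne hn ha hT hirr (i j₀) hm ?_
  rw [← hend, ← Function.iterate_add_apply, add_comm, Function.iterate_add_apply, hper]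

end Exchange

section Rigid

variable {T : ℝ → ℝ}

/-- All forward iterates of `T` act as translations on `[x, x + δ) ⊆ [0, 1)`. -/
def IsRigid (T : ℝ → ℝ) (x δ : ℝ) : Prop :=
  0 ≤ x ∧ x + δ ≤ 1 ∧ ∀ k : ℕ, ∀ s ∈ Ico 0 δ, T^[k] (x + s) = T^[k] x + s

theorem IsRigid.iterate (hmaps : MapsTo T (Ico 0 1) (Ico 0 1)) {x δ : ℝ} (hδ : 0 < δ)
    (h : IsRigid T x δ) (m : ℕ) : IsRigid T (T^[m] x) δ := by
  obtain ⟨h0, h1, h⟩ := h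
  have hmem : ∀ s ∈ Ico 0 δ, T^[m] x + s ∈ Ico (0 : ℝ) 1 := by
    intro s hs
    rw [← h m s hs]
    exact hmaps.iterate m ⟨by linarith [hs.1], by linarith [hs.2]⟩
  refine ⟨by simpa using (hmem 0 ⟨le_rfl, hδ⟩).1, ?_, ?_⟩
  · by_contra! hlt
    have hpos := hmem 0 ⟨le_rfl, hδ⟩
    have := (hmem (1 - T^[m] x) ⟨by linarith [hpos.2], by linarith⟩).2
    linarith
  · intro k s hs
    rw [← h m s hs, ← Function.iterate_add_apply, ← Function.iterate_add_apply, h _ s hs]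

theorem IsRigid.union {x y δ ε : ℝ} (hx : IsRigid T x δ) (hy : IsRigid T y ε) (hxy : x ≤ y)
    (hyx : y < x + δ) : IsRigid T x (y + ε - x) := by
  refine ⟨hx.1, by linarith [hy.2.1], fun k s hs => ?_⟩
  rcases lt_or_ge s (y - x) with hs' | hs'
  · exact hx.2.2 k s ⟨hs.1, by linarith⟩
  · have h1 := hy.2.2 k (x + s - y) ⟨by linarith, by linarith [hs.2]⟩
    have h2 := hx.2.2 k (y - x) ⟨by linarith, by linarith⟩
    rw [add_sub_cancel] at h1 h2
    linarith

/-- A self-map of `[0, 1)` without periodic points has no rigid interval. -/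
theorem not_isRigid (hmaps : MapsTo T (Ico 0 1) (Ico 0 1))
    (haper : ∀ x ∈ Ico (0 : ℝ) 1, ∀ m : ℕ, 0 < m → T^[m] x ≠ x) {x δ : ℝ} (hδ : 0 < δ) :
    ¬ IsRigid T x δ := by
  intro hrig
  have hxI : x ∈ Ico (0 : ℝ) 1 := ⟨hrig.1, by linarith [hrig.2.1]⟩
  have hmem : ∀ j, T^[j] x ∈ Ico (0 : ℝ) 1 := fun j => hmaps.iterate j hxI
  have hfl : ∀ j, ⌊T^[j] x / δ⌋ ∈ Icc (0 : ℤ) ⌊1 / δ⌋ := fun j =>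
    ⟨Int.floor_nonneg.2 (div_nonneg (hmem j).1 hδ.le),
      Int.floor_mono (div_le_div_of_nonneg_right (hmem j).2.le hδ.le)⟩
  obtain ⟨p, q, hpq, heq⟩ := Finite.exists_ne_map_eq_of_infinite
    (fun j : ℕ => (⟨⌊T^[j] x / δ⌋, hfl j⟩ : Icc (0 : ℤ) ⌊1 / δ⌋))
  have hclose : ∀ p q : ℕ, ⌊T^[p] x / δ⌋ = ⌊T^[q] x / δ⌋ → |T^[q] x - T^[p] x| < δ := by
    intro p q h
    have h1 := Int.abs_sub_lt_one_of_floor_eq_floor h.symm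
    rwa [← sub_div, abs_div, abs_of_pos hδ, div_lt_one hδ] at h1
  replace heq : ⌊T^[p] x / δ⌋ = ⌊T^[q] x / δ⌋ := congrArg Subtype.val heq
  obtain ⟨y, m, hm, hy, hclose⟩ : ∃ y, ∃ m : ℕ, 0 < m ∧ IsRigid T y δ ∧ |T^[m] y - y| < δ := by
    rcases lt_or_gt_of_ne hpq with h | h
    · refine ⟨T^[p] x, q - p, by omega, hrig.iterate hmaps hδ p, ?_⟩
      rw [← Function.iterate_add_apply, Nat.sub_add_cancel h.le]
      exact hclose p q heq
    · refine ⟨T^[q] x, p - q, by omega, hrig.iterate hmaps hδ q, ?_⟩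
      rw [← Function.iterate_add_apply, Nat.sub_add_cancel h.le]
      exact hclose q p heq.symm
  have hyI : y ∈ Ico (0 : ℝ) 1 := ⟨hy.1, by linarith [hy.2.1]⟩
  obtain ⟨hl, hu⟩ := abs_lt.1 hclose
  rcases lt_or_gt_of_ne (haper y hyI m hm) with ht | ht
  · set t := y - T^[m] y with ht_def
    have ht0 : 0 < t := sub_pos.2 ht
    have key : ∀ N : ℕ, IsRigid T (y - N * t) (δ + N * t) ∧
        T^[m] (y - N * t) = y - N * t - t := by
      intro N
      induction N with
      | zero => simpa using ⟨hy, by linarith⟩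
      | succ N ih =>
        obtain ⟨h1, h2⟩ := ih
        have hNt : 0 ≤ (N : ℝ) * t := by positivity
        have h3 := h1.iterate hmaps (by linarith) m
        rw [h2] at h3
        have h4 := h3.union h1 (by linarith) (by linarith)
        have e1 : y - ((N + 1 : ℕ) : ℝ) * t = y - N * t - t := by push_cast; ring
        have e2 : δ + ((N + 1 : ℕ) : ℝ) * t
            = y - N * t + (δ + N * t) - (y - N * t - t) := by push_cast; ring
        rw [e1, e2]
        refine ⟨h4, ?_⟩
        have h5 := h4.2.2 m t ⟨ht0.le, by linarith⟩
        rw [sub_add_cancel, h2] at h5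
        linarith
    obtain ⟨N, hN⟩ := exists_nat_gt (1 / t)
    rw [div_lt_iff₀ ht0] at hN
    have := (key N).1.1
    linarith [hyI.2]
  · set t := T^[m] y - y with ht_def
    have ht0 : 0 < t := sub_pos.2 ht
    have key : ∀ N : ℕ, IsRigid T y (δ + N * t) := by
      intro N
      induction N with
      | zero => simpa using hy
      | succ N ih =>
        have hNt : 0 ≤ (N : ℝ) * t := by positivity
        have h3 := ih.iterate hmaps (by linarith) m
        have h4 := ih.union h3 (by linarith) (by linarith)
        have e2 : δ + ((N + 1 : ℕ) : ℝ) * t = T^[m] y + (δ + N * t) - y := by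
          push_cast
          linarith
        rwa [e2]
    obtain ⟨N, hN⟩ := exists_nat_gt (1 / t)
    rw [div_lt_iff₀ ht0] at hN
    have := (key N).2.1
    linarith [hyI.1]

end Rigid

section Tracks

variable {n : ℕ} {a : Fin n → ℝ} {τ : Equiv.Perm (Fin n)} {T Tt : ℝ → ℝ} {P Pt : ℤ → ℝ → ℝ}
  {I It : ℝ → ℤ → Fin n} {α β : ℤ → Fin n} {X Y : ℤ → ℝ}

/-- `X` moves by the translations prescribed by `α`, staying in the closed intervals `α` names. -/
def IsTrack (a : Fin n → ℝ) (τ : Equiv.Perm (Fin n)) (α : ℤ → Fin n) (X : ℤ → ℝ) : Prop :=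
  ∀ k, X k ∈ Icc (bpt a (α k)) (bpt a ((α k : ℕ) + 1)) ∧ X (k + 1) = X k + displacement a τ (α k)

theorem IsItin.isTrack (hT : IsLrIET a τ T) (hP : IsZIterLr T P) (hI : IsItin a P I) {x : ℝ}
    (hx : x ∈ Ico (0 : ℝ) 1) : IsTrack a τ (I x) (fun k => P k x) := by
  intro k
  have h := (hI x hx k _).1 rfl
  exact ⟨Ico_subset_Icc_self h, (hP.2 k x hx).2.trans (hT.apply_eq h)⟩

theorem IsItinDual.isTrack (hTt : IslRIET a τ Tt) (hPt : IsZIterlR Tt Pt)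
    (hIt : IsItinDual a Pt It) {x : ℝ} (hx : x ∈ Ioc (0 : ℝ) 1) :
    IsTrack a τ (It x) (fun k => Pt k x) := by
  intro k
  have h := (hIt x hx k _).1 rfl
  exact ⟨Ioc_subset_Icc_self h, (hPt.2 k x hx).2.trans (hTt.apply_eq h)⟩

theorem IsTrack.not_lt (ha : IsProbVec a) (hT : IsLrIET a τ T)
    (haper : ∀ x ∈ Ico (0 : ℝ) 1, ∀ m : ℕ, 0 < m → T^[m] x ≠ x)
    (hX : IsTrack a τ α X) (hY : IsTrack a τ β Y) {N : ℤ} (hN : ∀ i ≥ N, α i = β i) :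
    ¬ X N < Y N := by
  intro hlt
  have hdiff : ∀ k : ℕ, Y (N + k) = X (N + k) + (Y N - X N) := by
    intro k
    induction k with
    | zero => simp
    | succ k ih =>
      push_cast
      rw [← add_assoc, (hX _).2, (hY _).2, ih, hN (N + k) (by omega)]
      ring
  have hmove : ∀ k : ℕ, ∀ s ∈ Ioo 0 (Y N - X N), T^[k] (X N + s) = X (N + k) + s := by
    intro k s hs
    induction k with
    | zero => simp
    | succ k ih =>
      have h1 := (hX (N + k)).1.1
      have h2 := (hY (N + k)).1.2
      rw [hdiff, ← hN (N + k) (by omega)] at h2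
      have hmem : X (N + k) + s ∈ Jint a (α (N + k)) := ⟨by linarith [hs.1], by linarith [hs.2]⟩
      push_cast
      rw [Function.iterate_succ_apply', ih, hT.apply_eq hmem, ← add_assoc, (hX _).2]
      ring
  set δ := (Y N - X N) / 2 with hδ
  have hδ0 : 0 < δ := by linarith
  refine not_isRigid (hT.mapsTo ha) haper (x := X N + δ) hδ0 ⟨?_, ?_, ?_⟩
  · linarith [(hX N).1.1, bpt_nonneg ha (α N)]
  · linarith [(hY N).1.2, bpt_le_one ha (β N).2]
  · intro k s hs
    rw [add_assoc, hmove k (δ + s) ⟨by linarith [hs.1], by linarith [hs.2]⟩,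
      hmove k δ ⟨hδ0, by linarith⟩, add_assoc]

theorem IsTrack.eq_of_forall_ge (ha : IsProbVec a) (hT : IsLrIET a τ T)
    (haper : ∀ x ∈ Ico (0 : ℝ) 1, ∀ m : ℕ, 0 < m → T^[m] x ≠ x)
    (hX : IsTrack a τ α X) (hY : IsTrack a τ β Y) {N : ℤ} (hN : ∀ i ≥ N, α i = β i) :
    X N = Y N :=
  le_antisymm (_root_.not_lt.1 (hY.not_lt ha hT haper hX fun i hi => (hN i hi).symm))
    (_root_.not_lt.1 (hX.not_lt ha hT haper hY hN))

/-- A family of `ℤ`-iterates of an injective map is a flow. -/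
theorem zIter_add {T : ℝ → ℝ} {P : ℤ → ℝ → ℝ} {s : Set ℝ} (hinj : InjOn T s)
    (h0 : ∀ x ∈ s, P 0 x = x) (h1 : ∀ k : ℤ, ∀ x ∈ s, P k x ∈ s ∧ P (k + 1) x = T (P k x))
    {x : ℝ} (hx : x ∈ s) (j k : ℤ) : P j (P k x) = P (j + k) x := by
  have hk := (h1 k x hx).1
  induction j with
  | zero => rw [h0 _ hk, zero_add]
  | succ j ih => rw [(h1 j _ hk).2, ih, ← (h1 _ x hx).2, add_right_comm]
  | pred j ih =>
    refine hinj (h1 _ _ hk).1 (h1 _ x hx).1 ?_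
    rw [← (h1 _ _ hk).2, ← (h1 _ x hx).2, sub_add_cancel, ih]
    congr 1
    ring

theorem IsItin.eq_shiftZ (ha : IsProbVec a) (hT : IsLrIET a τ T) (hP : IsZIterLr T P)
    (hI : IsItin a P I) {x : ℝ} (hx : x ∈ Ico (0 : ℝ) 1) (N : ℤ) :
    I x = shiftZ (-N) (I (P N x)) := by
  ext1 i
  refine ((hI _ (hP.2 N x hx).1 (i + -N) (I x i)).2 ?_).symm
  rw [zIter_add (hT.injOn ha) hP.1 hP.2 hx, neg_add_cancel_right]
  exact (hI x hx i _).1 rfl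

theorem IsItinDual.eq_shiftZ (ha : IsProbVec a) (hTt : IslRIET a τ Tt) (hPt : IsZIterlR Tt Pt)
    (hIt : IsItinDual a Pt It) {x : ℝ} (hx : x ∈ Ioc (0 : ℝ) 1) (N : ℤ) :
    It x = shiftZ (-N) (It (Pt N x)) := by
  ext1 i
  refine ((hIt _ (hPt.2 N x hx).1 (i + -N) (It x i)).2 ?_).symm
  rw [zIter_add (hTt.injOn ha) hPt.1 hPt.2 hx, neg_add_cancel_right]
  exact (hIt x hx i _).1 rfl

theorem exists_division_point_of_itin_ne (ha : IsProbVec a) (hT : IsLrIET a τ T)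
    (hTt : IslRIET a τ Tt) (hP : IsZIterLr T P) (hPt : IsZIterlR Tt Pt) (hI : IsItin a P I)
    (hIt : IsItinDual a Pt It) {x y : ℝ} (hx : x ∈ Ico (0 : ℝ) 1) (hy : y ∈ Ioc (0 : ℝ) 1) {N : ℤ}
    (hxy : P N x = Pt N y) (hne : I x (N - 1) ≠ It y (N - 1)) :
    ∃ i : ℕ, 0 < i ∧ i < n ∧ ∃ k : ℤ, I x = shiftZ k (I (bpt (aperm a τ) i)) ∧
      It y = shiftZ k (It (bpt (aperm a τ) i)) := by
  have hp := add_displacement_mem_Jint (τ := τ).2 ((hI x hx (N - 1) _).1 rfl)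
  have hq := add_displacement_mem_Jtil (τ := τ).2 ((hIt y hy (N - 1) _).1 rfl)
  have ep := (hI.isTrack hT hP hx (N - 1)).2
  have eq := (hIt.isTrack hTt hPt hy (N - 1)).2
  simp only [sub_add_cancel] at ep eq
  rw [← ep] at hp
  rw [← eq, ← hxy] at hq
  have hpt : P N x = bpt (aperm a τ) (τ (I x (N - 1))) := by
    by_contra hcon
    have hp' : P N x ∈ Jtil (aperm a τ) (τ (I x (N - 1))) :=
      ⟨lt_of_le_of_ne hp.1 (Ne.symm hcon), hp.2.le⟩
    exact hne (τ.injective (Jtil_unique (ha.aperm τ) hp' hq))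
  refine ⟨τ (I x (N - 1)), ?_, (τ (I x (N - 1))).2, -N, ?_, ?_⟩
  · refine Nat.pos_of_ne_zero fun h => ?_
    rw [h, bpt_zero, hxy] at hpt
    exact (hPt.2 N y hy).1.1.ne' hpt
  · rw [← hpt]
    exact hI.eq_shiftZ ha hT hP hx N
  · rw [← hpt, hxy]
    exact hIt.eq_shiftZ ha hTt hPt hy N

end Tracks

section Closure

open Filter Topology

variable {n : ℕ} {a : Fin n → ℝ} {τ : Equiv.Perm (Fin n)} {T Tt : ℝ → ℝ} {P Pt : ℤ → ℝ → ℝ}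
  {I It : ℝ → ℤ → Fin n}

/-- If `T` translates `z ∈ [0, 1)` to `w` in the `j`-th exchanged image interval, then `z` lies in
the interval that is mapped there. -/
theorem IsLrIET.eq_sub_displacement (ha : IsProbVec a) (hT : IsLrIET a τ T) {z : ℝ}
    (hz : z ∈ Ico (0 : ℝ) 1) {i : Fin n} (h : T z ∈ Jint (aperm a τ) (τ i)) :
    z = T z - displacement a τ i := by
  obtain ⟨j, hj⟩ := exists_mem_Jint ha hz
  have hj' := add_displacement_mem_Jint (τ := τ).2 hj
  rw [← hT.apply_eq hj] at hj'
  obtain rfl := τ.injective (Jint_unique (ha.aperm τ) hj' h)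
  rw [hT.apply_eq hj]
  ring

theorem zIter_eventually_add (ha : IsProbVec a) (hT : IsLrIET a τ T) (hP : IsZIterLr T P)
    {x : ℝ} {X : ℤ → ℝ} {α : ℤ → Fin n} (hX0 : X 0 = x)
    (hstep : ∀ k, X (k + 1) = X k + displacement a τ (α k)) {l : Filter ℝ}
    (hl : ∀ᶠ y in l, y ∈ Ico (0 : ℝ) 1)
    (hmem : ∀ k, ∀ᶠ y in l, X k + (y - x) ∈ Jint a (α k)) (k : ℤ) :
    ∀ᶠ y in l, P k y = X k + (y - x) := by
  induction k with
  | zero =>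
    filter_upwards [hl] with y hy
    rw [hP.1 y hy, hX0]
    ring
  | succ k ih =>
    filter_upwards [hl, hmem k, ih] with y hy hm h
    rw [(hP.2 _ y hy).2, h, hT.apply_eq hm, hstep]
    ring
  | pred k ih =>
    filter_upwards [hl, hmem (-k - 1), ih] with y hy hm h
    have e := (hP.2 (-k - 1) y hy).2
    have e2 := hstep (-k - 1)
    rw [sub_add_cancel] at e e2
    have h3 := add_displacement_mem_Jint (τ := τ).2 hm
    have h4 : T (P (-k - 1) y) = X (-k - 1) + (y - x) + displacement a τ (α (-k - 1)) := by
      rw [← e, h, e2]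
      ring
    rw [← h4] at h3
    rw [hT.eq_sub_displacement ha (hP.2 _ y hy).1 h3, h4]
    ring

/-- Along a filter compatible with a coding sequence, itineraries converge to that sequence. -/
theorem itin_eventually_eq (ha : IsProbVec a) (hT : IsLrIET a τ T) (hP : IsZIterLr T P)
    (hI : IsItin a P I) {x : ℝ} {X : ℤ → ℝ} {α : ℤ → Fin n} (hX0 : X 0 = x)
    (hstep : ∀ k, X (k + 1) = X k + displacement a τ (α k)) {l : Filter ℝ}
    (hl : ∀ᶠ y in l, y ∈ Ico (0 : ℝ) 1)
    (hmem : ∀ k, ∀ᶠ y in l, X k + (y - x) ∈ Jint a (α k)) (k : ℤ) :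
    ∀ᶠ y in l, I y k = α k := by
  filter_upwards [hl, hmem k, zIter_eventually_add ha hT hP hX0 hstep hl hmem k] with y hy hm h
  exact (hI y hy k _).2 (h ▸ hm)

theorem itin_eventually_eq_right (ha : IsProbVec a) (hT : IsLrIET a τ T) (hP : IsZIterLr T P)
    (hI : IsItin a P I) {x : ℝ} (hx : x ∈ Ico (0 : ℝ) 1) (k : ℤ) :
    ∀ᶠ y in 𝓝[≥] x, I y k = I x k := by
  refine itin_eventually_eq ha hT hP hI (X := fun k => P k x) (hP.1 x hx)
    (fun k => (hI.isTrack hT hP hx k).2) ?_ ?_ k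
  · filter_upwards [self_mem_nhdsWithin, nhdsWithin_le_nhds (Iio_mem_nhds hx.2)] with y h1 h2
    exact ⟨hx.1.trans h1, h2⟩
  · intro k
    have h := (hI x hx k _).1 rfl
    have hlt : x < x + (bpt a ((I x k : ℕ) + 1) - P k x) := by linarith [h.2]
    filter_upwards [self_mem_nhdsWithin, nhdsWithin_le_nhds (Iio_mem_nhds hlt)] with y h1 h2
    simp only [mem_Ici, mem_Iio] at h1 h2
    exact ⟨by linarith [h.1], by linarith⟩

theorem itin_eventually_eq_left (ha : IsProbVec a) (hT : IsLrIET a τ T) (hTt : IslRIET a τ Tt)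
    (hP : IsZIterLr T P) (hPt : IsZIterlR Tt Pt) (hI : IsItin a P I) (hIt : IsItinDual a Pt It)
    {x : ℝ} (hx : x ∈ Ioc (0 : ℝ) 1) (k : ℤ) : ∀ᶠ y in 𝓝[<] x, I y k = It x k := by
  refine itin_eventually_eq ha hT hP hI (X := fun k => Pt k x) (hPt.1 x hx)
    (fun k => (hIt.isTrack hTt hPt hx k).2) ?_ ?_ k
  · filter_upwards [self_mem_nhdsWithin, nhdsWithin_le_nhds (Ioi_mem_nhds hx.1)] with y h1 h2
    exact ⟨le_of_lt h2, lt_of_lt_of_le h1 hx.2⟩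
  · intro k
    have h := (hIt x hx k _).1 rfl
    have hlt : x - (Pt k x - bpt a (It x k)) < x := by linarith [h.1]
    filter_upwards [self_mem_nhdsWithin, nhdsWithin_le_nhds (Ioi_mem_nhds hlt)] with y h1 h2
    simp only [mem_Iio, mem_Ioi] at h1 h2
    exact ⟨by linarith, by linarith [h.2]⟩

/-- Every point of the closure of the regular itineraries is an itinerary of `T` or of its dual. -/
theorem mem_closure_itin (ha : IsProbVec a) (hT : IsLrIET a τ T) (hTt : IslRIET a τ Tt)
    (hP : IsZIterLr T P) (hPt : IsZIterlR Tt Pt) (hI : IsItin a P I) (hIt : IsItinDual a Pt It)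
    {α : ℤ → Fin n} (hα : α ∈ closure (I '' Rset a P)) :
    (∃ x ∈ Ico (0 : ℝ) 1, α = I x) ∨ ∃ x ∈ Ioc (0 : ℝ) 1, α = It x := by
  have hR : Rset a P ⊆ Ico 0 1 := fun y hy =>
    ⟨hy.1.1, lt_of_le_of_ne hy.1.2 fun h => hy.2 (Or.inl (Or.inr h))⟩
  obtain ⟨G, hG, hGα⟩ := mem_closure_iff_ultrafilter.1 hα
  set U := Ultrafilter.ofComapInfPrincipal hG
  have hUR : ∀ᶠ y in (U : Filter ℝ), y ∈ Ico (0 : ℝ) 1 :=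
    mem_of_superset (Ultrafilter.ofComapInfPrincipal_mem hG) hR
  have hlim : Tendsto I (U : Filter ℝ) (𝓝 α) := by
    rw [Tendsto, ← Ultrafilter.coe_map, Ultrafilter.ofComapInfPrincipal_eq_of_map hG]
    exact hGα
  have hcoord : ∀ k, ∀ᶠ y in (U : Filter ℝ), I y k = α k := by
    intro k
    have := (tendsto_pi_nhds.1 hlim) k
    rw [nhds_discrete, tendsto_pure] at this
    exact this
  obtain ⟨x, hx, hUx⟩ := isCompact_Icc.ultrafilter_le_nhds U
    (le_principal_iff.2 (hUR.mono fun y hy => Ico_subset_Icc_self hy) :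
      (U : Filter ℝ) ≤ 𝓟 (Icc (0 : ℝ) 1))
  rcases U.em (fun y => x ≤ y) with hside | hside
  · left
    have hU : (U : Filter ℝ) ≤ 𝓝[≥] x := le_inf hUx (le_principal_iff.2 hside)
    obtain ⟨y, hy, hxy⟩ := (hUR.and hside).exists
    have hx' : x ∈ Ico (0 : ℝ) 1 := ⟨hx.1, lt_of_le_of_lt hxy hy.2⟩
    refine ⟨x, hx', funext fun k => ?_⟩
    obtain ⟨y, h1, h2⟩ :=
      ((hcoord k).and (hU (itin_eventually_eq_right ha hT hP hI hx' k))).exists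
    exact h1.symm.trans h2
  · right
    have hside' : ∀ᶠ y in (U : Filter ℝ), y < x := hside.mono fun y hy => not_le.1 hy
    have hU : (U : Filter ℝ) ≤ 𝓝[<] x := le_inf hUx (le_principal_iff.2 hside')
    obtain ⟨y, hy, hxy⟩ := (hUR.and hside').exists
    have hx' : x ∈ Ioc (0 : ℝ) 1 := ⟨lt_of_le_of_lt hy.1 hxy, hx.2⟩
    refine ⟨x, hx', funext fun k => ?_⟩
    obtain ⟨y, h1, h2⟩ :=
      ((hcoord k).and (hU (itin_eventually_eq_left ha hT hTt hP hPt hI hIt hx' k))).exists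
    exact h1.symm.trans h2

end Closure

section DivisionPointItineraries

variable {n : ℕ} {a : Fin n → ℝ} {τ : Equiv.Perm (Fin n)} {T Tt : ℝ → ℝ} {P Pt : ℤ → ℝ → ℝ}
  {I It : ℝ → ℤ → Fin n}

theorem zIter_natCast (hP : IsZIterLr T P) {x : ℝ} (hx : x ∈ Ico (0 : ℝ) 1) (k : ℕ) :
    P k x = T^[k] x := by
  induction k with
  | zero => exact hP.1 x hx
  | succ k ih =>
    push_cast
    rw [(hP.2 k x hx).2, ih, Function.iterate_succ_apply']

theorem exists_iterate_eq_bpt_aperm (hn : 2 ≤ n) (ha : IsProbVec a) (hT : IsLrIET a τ T)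
    (hirr : IrreduciblePerm τ) {j : ℕ} (hj : j < n) :
    ∃ d ∈ Dset a, ∃ m : ℕ, 0 < m ∧ bpt (aperm a τ) j = T^[m] d := by
  have h : T (bpt a (τ.symm ⟨j, hj⟩)) = bpt (aperm a τ) j := by
    rw [hT.apply_eq ⟨le_rfl, bpt_lt_succ ha _⟩, displacement]
    simp
  rcases bpt_eq_zero_or_mem_Dset a (τ.symm ⟨j, hj⟩) with h0 | hD
  · obtain ⟨d, hd, hTd⟩ := hT.exists_bpt_eq_zero hn ha hirr
    refine ⟨d, hd, 2, two_pos, ?_⟩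
    rw [← h, h0, ← hTd]
    rfl
  · exact ⟨_, hD, 1, one_pos, h.symm⟩

theorem iterate_bpt_aperm_notMem (hn : 2 ≤ n) (ha : IsProbVec a) (hT : IsLrIET a τ T)
    (hirr : IrreduciblePerm τ) (hK : KeaneCond a T) {j : ℕ} (hj : j < n) (k : ℕ) :
    T^[k] (bpt (aperm a τ) j) ∉ Dset a := by
  obtain ⟨d, hd, m, hm, h⟩ := exists_iterate_eq_bpt_aperm hn ha hT hirr hj
  rw [h, ← Function.iterate_add_apply]
  exact hK.iterate_notMem (by omega) hd

theorem iterate_bpt_aperm_ne_zero (hn : 2 ≤ n) (ha : IsProbVec a) (hT : IsLrIET a τ T)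
    (hirr : IrreduciblePerm τ) (hK : KeaneCond a T) {j : ℕ} (h0 : 0 < j) (hj : j < n) (k : ℕ) :
    T^[k] (bpt (aperm a τ) j) ≠ 0 := by
  have hpos := bpt_pos (ha.aperm τ) h0 hj.le
  cases k with
  | zero => exact hpos.ne'
  | succ k =>
    intro h
    obtain ⟨d, hd, hTd⟩ := hT.exists_bpt_eq_zero hn ha hirr
    rw [Function.iterate_succ_apply', ← hTd] at h
    have := hT.injOn ha ((hT.mapsTo ha).iterate k ⟨hpos.le, bpt_lt_one (ha.aperm τ) hj⟩)
      (Ioo_subset_Ico_self (Dset_subset ha hd)) h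
    exact iterate_bpt_aperm_notMem hn ha hT hirr hK hj k (this ▸ hd)

theorem itin_bpt_aperm_eq_dual (hn : 2 ≤ n) (ha : IsProbVec a) (hT : IsLrIET a τ T)
    (hTt : IslRIET a τ Tt) (hP : IsZIterLr T P) (hPt : IsZIterlR Tt Pt) (hI : IsItin a P I)
    (hIt : IsItinDual a Pt It) (hirr : IrreduciblePerm τ) (hK : KeaneCond a T) {j : ℕ}
    (h0 : 0 < j) (hj : j < n) (k : ℕ) :
    I (bpt (aperm a τ) j) k = It (bpt (aperm a τ) j) k := by
  set x := bpt (aperm a τ) j with hxdef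
  have hpos : 0 < x := bpt_pos (ha.aperm τ) h0 hj.le
  have hlt : x < 1 := bpt_lt_one (ha.aperm τ) hj
  have hx : x ∈ Ico (0 : ℝ) 1 := ⟨hpos.le, hlt⟩
  have hx' : x ∈ Ioc (0 : ℝ) 1 := ⟨hpos, hlt.le⟩
  have hmem : ∀ k : ℕ, P k x ∈ Jtil a (I x k) := by
    intro k
    have h := (hI x hx k _).1 rfl
    refine ⟨lt_of_le_of_ne h.1 fun he => ?_, h.2.le⟩
    rw [zIter_natCast hP hx] at he
    rcases bpt_eq_zero_or_mem_Dset a (I x k) with hz | hD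
    · exact iterate_bpt_aperm_ne_zero hn ha hT hirr hK h0 hj k (he.symm.trans hz)
    · exact iterate_bpt_aperm_notMem hn ha hT hirr hK hj k (he ▸ hD)
  have heq : ∀ k : ℕ, Pt k x = P k x := by
    intro k
    induction k with
    | zero => exact (hPt.1 x hx').trans (hP.1 x hx).symm
    | succ k ih =>
      push_cast
      rw [(hPt.2 k x hx').2, ih, hTt.apply_eq (hmem k)]
      exact (hI.isTrack hT hP hx k).2.symm
  exact ((hIt x hx' k _).2 (heq k ▸ hmem k)).symm

end DivisionPointItineraries

theorem PosAsymp.symm {n : ℕ} {α β : ℤ → Fin n} (h : PosAsymp α β) : PosAsymp β α :=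
  h.imp fun _ hN i hi => (hN i hi).symm

theorem PosAsymp.exists_last_ne {n : ℕ} {α β : ℤ → Fin n} (h : PosAsymp α β) (hne : α ≠ β) :
    ∃ N : ℤ, (∀ i ≥ N, α i = β i) ∧ α (N - 1) ≠ β (N - 1) := by
  obtain ⟨M, hM⟩ := h
  obtain ⟨m, hm, hmax⟩ := Int.exists_greatest_of_bdd (P := fun i => α i ≠ β i)
    ⟨M, fun i hi => not_lt.1 fun hlt => hi (hM i hlt.le)⟩ (Function.ne_iff.1 hne)
  refine ⟨m + 1, fun i hi => ?_, by simpa using hm⟩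
  by_contra hcon
  have := hmax i hcon
  omega

/-- Theorem 4.5 (i): under irreducibility and the Keane Condition,
distinct `α, β ∈ X` form a positively asymptotic pair iff there are `i ∈ {1,…,n-1}`
and `k ∈ ℤ` such that, with `x = b^τ_i ∈ D^τ`,
`{α, β} = {S^k 𝓘(x), S^k 𝓘̃(x)}`. -/
theorem stmt15 {n : ℕ} (hn : 2 ≤ n) (a : Fin n → ℝ) (ha : IsProbVec a)
    (τ : Equiv.Perm (Fin n)) (T Tt : ℝ → ℝ)
    (hT : IsLrIET a τ T) (hTt : IslRIET a τ Tt)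
    (P Pt : ℤ → ℝ → ℝ) (hP : IsZIterLr T P) (hPt : IsZIterlR Tt Pt)
    (I It : ℝ → ℤ → Fin n) (hI : IsItin a P I) (hIt : IsItinDual a Pt It)
    (hirr : IrreduciblePerm τ) (hKeane : KeaneCond a T)
    (α β : ℤ → Fin n) (hα : α ∈ closure (I '' Rset a P))
    (hβ : β ∈ closure (I '' Rset a P)) (hne : α ≠ β) :
    PosAsymp α β ↔
      ∃ i : ℕ, 0 < i ∧ i < n ∧ ∃ k : ℤ,
        ({α, β} : Set (ℤ → Fin n)) =
          {shiftZ k (I (bpt (aperm a τ) i)), shiftZ k (It (bpt (aperm a τ) i))} := by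
  have haper : ∀ x ∈ Ico (0 : ℝ) 1, ∀ m : ℕ, 0 < m → T^[m] x ≠ x := fun x hx m hm =>
    hKeane.aperiodic hn ha hT hirr hx hm
  constructor
  · intro has
    obtain ⟨N, hN, hlast⟩ := has.exists_last_ne hne
    rcases mem_closure_itin ha hT hTt hP hPt hI hIt hα with ⟨x, hx, rfl⟩ | ⟨x, hx, rfl⟩ <;>
      rcases mem_closure_itin ha hT hTt hP hPt hI hIt hβ with ⟨y, hy, rfl⟩ | ⟨y, hy, rfl⟩
    · have h := (hI.isTrack hT hP hx).eq_of_forall_ge ha hT haper (hI.isTrack hT hP hy) hN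
      refine absurd ?_ hne
      rw [hI.eq_shiftZ ha hT hP hx N, hI.eq_shiftZ ha hT hP hy N, h]
    · have h := (hI.isTrack hT hP hx).eq_of_forall_ge ha hT haper (hIt.isTrack hTt hPt hy) hN
      obtain ⟨i, h0, hi, k, e1, e2⟩ :=
        exists_division_point_of_itin_ne ha hT hTt hP hPt hI hIt hx hy h hlast
      exact ⟨i, h0, hi, k, by rw [← e1, ← e2]⟩
    · have h := (hIt.isTrack hTt hPt hx).eq_of_forall_ge ha hT haper (hI.isTrack hT hP hy) hN
      obtain ⟨i, h0, hi, k, e1, e2⟩ :=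
        exists_division_point_of_itin_ne ha hT hTt hP hPt hI hIt hy hx h.symm hlast.symm
      exact ⟨i, h0, hi, k, by rw [← e1, ← e2, Set.pair_comm]⟩
    · have h := (hIt.isTrack hTt hPt hx).eq_of_forall_ge ha hT haper (hIt.isTrack hTt hPt hy) hN
      refine absurd ?_ hne
      rw [hIt.eq_shiftZ ha hTt hPt hx N, hIt.eq_shiftZ ha hTt hPt hy N, h]
  · rintro ⟨i, h0, hi, k, h⟩
    have key : PosAsymp (shiftZ k (I (bpt (aperm a τ) i))) (shiftZ k (It (bpt (aperm a τ) i))) := by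
      refine ⟨k.natAbs, fun l hl => ?_⟩
      obtain ⟨m, hm⟩ := Int.eq_ofNat_of_zero_le (show 0 ≤ l + k by omega)
      simp only [shiftZ, hm]
      exact itin_bpt_aperm_eq_dual hn ha hT hTt hP hPt hI hIt hirr hKeane h0 hi m
    rcases Set.pair_eq_pair_iff.1 h with ⟨rfl, rfl⟩ | ⟨rfl, rfl⟩
    · exact key
    · exact key.symm
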